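/- arXiv:1211.2718 — 2 statements merged into one kernel-verified Lean document; each statement's English description precedes it below -/
import Mathlib

section
/- Let J be a small category with the finite cone property: for every finite family of objects j₁, …, j_s of J there exist an object k and morphisms k → j_m in J for each 1 ≤ m ≤ s. Let F : J ⥤ TopCat be a functor such that every space F(j) is T1, and let X be a topological space equipped with a cone over F, i.e., continuous maps π_j : X → F(j) satisfying F(φ) ∘ π_j = π_{j'} for every morphism φ : j → j'. Assume every π_j is surjective and that at least one leg π_{j₀} is proper in the sense that the preimage of every compact subset of F(j₀) is compact. Then for every point y = (y_j) of the limit lim F, the fiber π⁻¹(y) of the induced map π : X → lim F is a nonempty compact subset of X; in particular π is surjective. -/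
open CategoryTheory

/-- The space of sections of a functor `F : J ⥤ TopCat`, i.e. the underlying set of the
limit `lim F`. -/
def Sections {J : Type u} [SmallCategory J] (F : J ⥤ TopCat) : Type u :=
  {y : ∀ j : J, F.obj j // ∀ ⦃j j'⦄ (φ : j ⟶ j'), F.map φ (y j) = y j'}

/-- Abstract form of Proposition 3.1: if `J` has the finite cone property, all spaces `F j`
are T1, all legs of the cone are continuous surjections and at least one leg is proper, then
every fiber of the induced map `X → lim F` is nonempty and compact; in particular the induced
map is surjective. -/
theorem fiber_nonempty_isCompact_of_properLeg
    {J : Type u} [SmallCategory J]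
    (hJ : ∀ s : Finset J, ∃ k : J, ∀ j ∈ s, Nonempty (k ⟶ j))
    (F : J ⥤ TopCat)
    (hT1 : ∀ j : J, T1Space (F.obj j))
    {X : Type v} [TopologicalSpace X]
    (π : ∀ j : J, X → F.obj j)
    (hcont : ∀ j : J, Continuous (π j))
    (hcone : ∀ ⦃j j' : J⦄ (φ : j ⟶ j') (x : X), F.map φ (π j x) = π j' x)
    (hsurj : ∀ j : J, Function.Surjective (π j))
    (j₀ : J)
    (hproper : ∀ C : Set (F.obj j₀), IsCompact C → IsCompact (π j₀ ⁻¹' C))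
    (y : Sections F) :
    ((fun x : X => (⟨fun j => π j x, fun _ _ φ => hcone φ x⟩ : Sections F)) ⁻¹' {y}).Nonempty ∧
      IsCompact ((fun x : X => (⟨fun j => π j x, fun _ _ φ => hcone φ x⟩ : Sections F)) ⁻¹' {y}) := by
  classical
  have hfib : ((fun x : X => (⟨fun j => π j x, fun _ _ φ => hcone φ x⟩ : Sections F)) ⁻¹' {y}) =
      π j₀ ⁻¹' {y.1 j₀} ∩ ⋂ j, π j ⁻¹' {y.1 j} := by
    ext x
    simp only [Set.mem_preimage, Set.mem_singleton_iff, Set.mem_inter_iff, Set.mem_iInter]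
    constructor
    · rintro rfl
      exact ⟨rfl, fun _ => rfl⟩
    · rintro ⟨-, h⟩
      exact Subtype.ext (funext h)
  have hclosed (j : J) : IsClosed (π j ⁻¹' {y.1 j}) :=
    haveI := hT1 j
    isClosed_singleton.preimage (hcont j)
  have hcompact : IsCompact (π j₀ ⁻¹' {y.1 j₀}) := hproper _ isCompact_singleton
  rw [hfib]
  refine ⟨hcompact.inter_iInter_nonempty _ hclosed fun s => ?_,
    hcompact.inter_right (isClosed_iInter hclosed)⟩
  obtain ⟨k, hk⟩ := hJ (insert j₀ s)
  obtain ⟨x, hx⟩ := hsurj k (y.1 k)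
  have hmem (j : J) (hj : j ∈ insert j₀ s) : π j x = y.1 j := by
    obtain ⟨φ⟩ := hk j hj
    rw [← hcone φ x, hx, y.2 φ]
  exact ⟨x, hmem j₀ (Finset.mem_insert_self _ _),
    Set.mem_iInter₂.2 fun j hj => hmem j (Finset.mem_insert_of_mem hj)⟩
end

section
/- Let J be a small category with the finite cone property: for every finite family of objects j₁, …, j_s of J there exist an object k and morphisms k → j_m for each m. Let F : J ⥤ TopCat be a functor with every F(j) a T1 space, and let X be a topological space with a cone (π_j : X → F(j)) over F in which every leg π_j is continuous and surjective and at least one leg is proper (preimages of compact sets are compact). Assume moreover that: (i) the legs separate points, i.e., for any distinct x, x' ∈ X there is an object j with π_j(x) ≠ π_j(x'); and (ii) there is an open cover {U_α} of X such that for each α there exist an object j_α and an open set V_α ⊆ F(j_α) with U_α = π_{j_α}⁻¹(V_α), and the subspace topology on U_α coincides with the initial topology induced by the family of restrictions {π_j|_{U_α} : j ∈ J}. Then the induced map π : X → lim F is a homeomorphism. -/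
open CategoryTheory Topology

/-- `lim F` carries the subspace topology of the product topology. -/
instance {J : Type u} [SmallCategory J] (F : J ⥤ TopCat) : TopologicalSpace (Sections F) :=
  inferInstanceAs (TopologicalSpace
    {y : ∀ j : J, F.obj j // ∀ ⦃j j'⦄ (φ : j ⟶ j'), F.map φ (y j) = y j'})

/-- The projection from the space of sections to a component is continuous. -/
theorem Sections.continuous_eval {J : Type u} [SmallCategory J] (F : J ⥤ TopCat) (j : J) :
    Continuous (fun y : Sections F => y.1 j) :=
  (continuous_apply j).comp continuous_subtype_val

/-- Every section of `F` comes from a point of `X`, by compactness of one fibre. -/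
theorem Sections.exists_forall_eq {J : Type u} [SmallCategory J]
    (hJ : ∀ s : Finset J, ∃ k : J, ∀ j ∈ s, Nonempty (k ⟶ j))
    (F : J ⥤ TopCat) (hT1 : ∀ j : J, T1Space (F.obj j))
    {X : Type v} [TopologicalSpace X] (π : ∀ j : J, X → F.obj j)
    (hcont : ∀ j : J, Continuous (π j))
    (hcone : ∀ ⦃j j' : J⦄ (φ : j ⟶ j') (x : X), F.map φ (π j x) = π j' x)
    (hsurj : ∀ j : J, Function.Surjective (π j)) (j₀ : J)
    (hproper : ∀ C : Set (F.obj j₀), IsCompact C → IsCompact (π j₀ ⁻¹' C))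
    (y : Sections F) : ∃ x : X, ∀ j : J, π j x = y.1 j := by
  classical
  obtain ⟨x, -, hx⟩ := (hproper {y.1 j₀} isCompact_singleton).inter_iInter_nonempty
    (fun j => π j ⁻¹' {y.1 j}) (fun j => isClosed_singleton.preimage (hcont j)) (fun s => by
      obtain ⟨k, hk⟩ := hJ (insert j₀ s)
      obtain ⟨x, hx⟩ := hsurj k (y.1 k)
      have hleg : ∀ j ∈ insert j₀ s, π j x = y.1 j := fun j hj => by
        obtain ⟨φ⟩ := hk j hj
        rw [← hcone φ x, hx, y.2 φ]
      exact ⟨x, hleg j₀ (Finset.mem_insert_self _ _),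
        Set.mem_iInter₂.2 fun j hj => hleg j (Finset.mem_insert_of_mem hj)⟩)
  exact ⟨x, fun j => Set.mem_iInter.1 hx j⟩

/-- If the subspace topology on a set `U` is the initial topology of a family of maps, and `U`
is itself a neighbourhood of `x` for that initial topology, then the initial topology
determines the neighbourhoods of `x`. -/
theorem iInf_comap_nhds_le_of_subtype {J X : Type*} [TopologicalSpace X] {Y : J → Type*}
    [∀ j, TopologicalSpace (Y j)] (f : ∀ j, X → Y j) {U : Set X} {x : X} (hx : x ∈ U)
    (hU : U ∈ ⨅ j, Filter.comap (f j) (𝓝 (f j x)))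
    (hinit : (inferInstance : TopologicalSpace U) =
      ⨅ j, TopologicalSpace.induced (fun z : U => f j z.1) inferInstance) :
    ⨅ j, Filter.comap (f j) (𝓝 (f j x)) ≤ 𝓝 x := by
  intro W hW
  have hnhds : 𝓝 (⟨x, hx⟩ : U) =
      Filter.comap Subtype.val (⨅ j, Filter.comap (f j) (𝓝 (f j x))) := by
    have h := congrArg (fun t : TopologicalSpace U => @nhds U t ⟨x, hx⟩) hinit
    simp only [nhds_iInf, nhds_induced] at h
    rw [Filter.comap_iInf]
    simp only [Filter.comap_comap]
    rw [nhds_subtype_eq_comap]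
    exact h
  have hW' : (Subtype.val ⁻¹' W : Set U) ∈ 𝓝 (⟨x, hx⟩ : U) :=
    continuous_subtype_val.continuousAt hW
  rw [hnhds, Filter.mem_comap] at hW'
  obtain ⟨t, ht, htW⟩ := hW'
  filter_upwards [ht, hU] with z hzt hzU
  exact @htW ⟨z, hzU⟩ hzt

/-- Abstract form of Theorem 1.1: if `J` has the finite cone property, the spaces `F j` are T1,
the legs `π j` are continuous surjections with at least one proper leg, the legs separate
points, and `X` has an open cover by preimages of open sets on which the subspace topology is
the initial topology of the restricted legs, then the induced map `X → lim F` is a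
homeomorphism. -/
theorem isHomeomorph_to_limit
    {J : Type u} [SmallCategory J]
    (hJ : ∀ s : Finset J, ∃ k : J, ∀ j ∈ s, Nonempty (k ⟶ j))
    (F : J ⥤ TopCat)
    (hT1 : ∀ j : J, T1Space (F.obj j))
    {X : Type v} [TopologicalSpace X]
    (π : ∀ j : J, X → F.obj j)
    (hcont : ∀ j : J, Continuous (π j))
    (hcone : ∀ ⦃j j' : J⦄ (φ : j ⟶ j') (x : X), F.map φ (π j x) = π j' x)
    (hsurj : ∀ j : J, Function.Surjective (π j))
    (j₀ : J)
    (hproper : ∀ C : Set (F.obj j₀), IsCompact C → IsCompact (π j₀ ⁻¹' C))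
    (hsep : ∀ x x' : X, x ≠ x' → ∃ j : J, π j x ≠ π j x')
    {ι : Type*} (U : ι → Set X)
    (hUopen : ∀ α, IsOpen (U α))
    (hUcov : ⋃ α, U α = Set.univ)
    (jα : ι → J) (V : ∀ α, Set (F.obj (jα α)))
    (hVopen : ∀ α, IsOpen (V α))
    (hUV : ∀ α, U α = π (jα α) ⁻¹' V α)
    (hinit : ∀ α, (inferInstance : TopologicalSpace (U α)) =
      ⨅ j : J, TopologicalSpace.induced (fun x : U α => π j x.1) inferInstance) :
    IsHomeomorph (fun x : X => (⟨fun j => π j x, fun _ _ φ => hcone φ x⟩ : Sections F)) := by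
  rw [isHomeomorph_iff_isEmbedding_surjective]
  refine ⟨⟨isInducing_iff_nhds.2 fun x => le_antisymm ?_ ?_, fun x x' h => ?_⟩, fun y => ?_⟩
  · exact Continuous.continuousAt
      (Continuous.subtype_mk (continuous_pi hcont) fun x _ _ φ => hcone φ x) |>.le_comap
  · obtain ⟨α, hα⟩ := Set.mem_iUnion.1 (hUcov.symm ▸ Set.mem_univ x : x ∈ ⋃ α, U α)
    refine le_trans (le_iInf fun j => ?_)
      (iInf_comap_nhds_le_of_subtype π hα ?_ (hinit α))
    · exact (Filter.comap_mono (Sections.continuous_eval F j).continuousAt.le_comap).trans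
        Filter.comap_comap.le
    · refine Filter.mem_iInf_of_mem (jα α) ?_
      rw [hUV α] at hα ⊢
      exact Filter.preimage_mem_comap ((hVopen α).mem_nhds hα)
  · by_contra hne
    obtain ⟨j, hj⟩ := hsep x x' hne
    exact hj (congrArg (fun y : Sections F => y.1 j) h)
  · obtain ⟨x, hx⟩ := Sections.exists_forall_eq hJ F hT1 π hcont hcone hsurj j₀ hproper y
    exact ⟨x, Subtype.ext (funext hx)⟩
end
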